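/- arXiv:1807.03896 — 4 statements merged into one kernel-verified Lean document; each statement's English description precedes it below -/
import Mathlib

section
/- Let 𝔤 = 2𝒜₂ be the 4-dimensional real Lie algebra with brackets [e₁,e₂] = e₂ and [e₃,e₄] = e₄. Let a₁₂, a₃₄ ∈ ℝ and set a₅ = (1+a₃₄²)/(1+a₁₂²), and assume a₅ ≠ 1. Then the inner product g = e¹⊗e¹ + e²⊗e² + a₅ e³⊗e³ + e⁴⊗e⁴ together with the 2-form F = a₁₂ e¹∧e² + a₃₄ e³∧e⁴ is a solution of the Einstein–Maxwell equations, and g is not Einstein. -/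
open scoped BigOperators

noncomputable section

/-- The underlying vector space `ℝ⁴` of the 4-dimensional Lie algebra. -/
abbrev V4 : Type := Fin 4 → ℝ

/-- The standard basis `e₁, e₂, e₃, e₄` (0-indexed). -/
def ee (i : Fin 4) : V4 := Pi.single i 1

/-- `g` is an inner product: a positive-definite symmetric bilinear form. -/
structure IsInnerProduct (g : V4 → V4 → ℝ) : Prop where
  symm : ∀ x y, g x y = g y x
  add_left : ∀ x y z, g (x + y) z = g x z + g y z
  smul_left : ∀ (a : ℝ) (x y : V4), g (a • x) y = a * g x y
  pos : ∀ x : V4, x ≠ 0 → 0 < g x x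

/-- `F` is an alternating bilinear 2-form. -/
structure IsAltForm (F : V4 → V4 → ℝ) : Prop where
  skew : ∀ x y, F x y = - F y x
  add_left : ∀ x y z, F (x + y) z = F x z + F y z
  smul_left : ∀ (a : ℝ) (x y : V4), F (a • x) y = a * F x y

/-- Chevalley–Eilenberg differential of a 2-form with respect to the bracket `br`:
`dF(x,y,z) = −F([x,y],z) + F([x,z],y) − F([y,z],x)`. -/
def cdiff (br : V4 → V4 → V4) (F : V4 → V4 → ℝ) (x y z : V4) : ℝ :=
  - F (br x y) z + F (br x z) y - F (br y z) x

/-- A 2-form is closed if its Chevalley–Eilenberg differential vanishes. -/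
def IsClosedForm (br : V4 → V4 → V4) (F : V4 → V4 → ℝ) : Prop :=
  ∀ x y z, cdiff br F x y z = 0

/-- The Gram matrix of a bilinear form in the standard basis. -/
def gram (g : V4 → V4 → ℝ) : Matrix (Fin 4) (Fin 4) ℝ :=
  Matrix.of fun i j => g (ee i) (ee j)

/-- The inverse Gram matrix. -/
def ginv (g : V4 → V4 → ℝ) : Matrix (Fin 4) (Fin 4) ℝ := (gram g)⁻¹

/-- The inner product induced by `g` on 2-forms:
`⟨α,β⟩ = (1/2) Σ g^{ik} g^{jl} α_{ij} β_{kl}`. -/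
def formInner (g : V4 → V4 → ℝ) (α β : V4 → V4 → ℝ) : ℝ :=
  (1 / 2) * ∑ i, ∑ j, ∑ k, ∑ l,
    ginv g i k * ginv g j l * α (ee i) (ee j) * β (ee k) (ee l)

/-- The volume form of `g` for the orientation `e¹∧e²∧e³∧e⁴`. -/
def vol (g : V4 → V4 → ℝ) (x y z w : V4) : ℝ :=
  Real.sqrt (gram g).det * Matrix.det (Matrix.of fun i j => ![x, y, z, w] i j)

/-- The wedge product of two 2-forms, as a 4-form. -/
def wedge22 (α β : V4 → V4 → ℝ) (x y z w : V4) : ℝ :=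
  α x y * β z w - α x z * β y w + α x w * β y z
    + α z w * β x y - α y w * β x z + α y z * β x w

/-- `sF` is the Hodge star `⋆F` of `F` with respect to `g` and the orientation
`e¹∧e²∧e³∧e⁴`: it is the 2-form with `α ∧ sF = ⟨α,F⟩_g vol_g` for all 2-forms `α`. -/
def IsHodgeStar (g : V4 → V4 → ℝ) (F sF : V4 → V4 → ℝ) : Prop :=
  IsAltForm sF ∧
    ∀ α : V4 → V4 → ℝ, IsAltForm α → ∀ x y z w,
      wedge22 α sF x y z w = formInner g α F * vol g x y z w

/-- `F` is co-closed: `d(⋆F) = 0`. -/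
def IsCoclosed (br : V4 → V4 → V4) (g F : V4 → V4 → ℝ) : Prop :=
  ∃ sF, IsHodgeStar g F sF ∧ IsClosedForm br sF

/-- Koszul expression: `g(∇ₓy, z) = (1/2)(g([x,y],z) − g([y,z],x) + g([z,x],y))`. -/
def koszul (br : V4 → V4 → V4) (g : V4 → V4 → ℝ) (x y z : V4) : ℝ :=
  (1 / 2) * (g (br x y) z - g (br y z) x + g (br z x) y)

/-- The Levi-Civita product `∇ₓ y`, i.e. the unique vector with
`g(∇ₓy, z) = koszul x y z` for all `z` (computed via the inverse Gram matrix). -/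
def LC (br : V4 → V4 → V4) (g : V4 → V4 → ℝ) (x y : V4) : V4 :=
  fun m => ∑ k, koszul br g x y (ee k) * ginv g k m

/-- Curvature `R(x,y)z = ∇ₓ∇_y z − ∇_y∇ₓ z − ∇_{[x,y]} z`. -/
def curv (br : V4 → V4 → V4) (g : V4 → V4 → ℝ) (x y z : V4) : V4 :=
  LC br g x (LC br g y z) - LC br g y (LC br g x z) - LC br g (br x y) z

/-- Ricci tensor `Ric(x,y) = Σᵢ g(R(vᵢ,x)y, vᵢ)` for a `g`-orthonormal basis `(vᵢ)`,
i.e. the trace of the endomorphism `z ↦ R(z,x)y`. -/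
def ricci (br : V4 → V4 → V4) (g : V4 → V4 → ℝ) (x y : V4) : ℝ :=
  ∑ i, curv br g (ee i) x y i

/-- Scalar curvature: the `g`-trace of the Ricci tensor. -/
def scal (br : V4 → V4 → V4) (g : V4 → V4 → ℝ) : ℝ :=
  ∑ a, ∑ b, ginv g a b * ricci br g (ee a) (ee b)

/-- Trace-free Ricci tensor `Ric₀ = Ric − (s/4) g`. -/
def ricci0 (br : V4 → V4 → V4) (g : V4 → V4 → ℝ) (x y : V4) : ℝ :=
  ricci br g x y - (scal br g / 4) * g x y

/-- `g` is Einstein: `Ric₀ = 0`. -/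
def IsEinstein (br : V4 → V4 → V4) (g : V4 → V4 → ℝ) : Prop :=
  ∀ x y, ricci0 br g x y = 0

/-- The endomorphism `F̂` with `g(F̂x, y) = F(x,y)` (computed via the inverse Gram matrix). -/
def fhat (g F : V4 → V4 → ℝ) (x : V4) : V4 :=
  fun m => ∑ k, F x (ee k) * ginv g k m

/-- `[F∘F]₀(x,y) = g(F̂(F̂x), y) − (1/4) tr(F̂∘F̂) g(x,y)`. -/
def FF0 (g F : V4 → V4 → ℝ) (x y : V4) : ℝ :=
  g (fhat g F (fhat g F x)) y
    - (1 / 4) * (∑ i, fhat g F (fhat g F (ee i)) i) * g x y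

/-- `(g, F)` is a solution of the Einstein--Maxwell equations:
`dF = 0`, `d(⋆F) = 0`, and `Ric₀ = −[F∘F]₀`. -/
def IsEMSolution (br : V4 → V4 → V4) (g F : V4 → V4 → ℝ) : Prop :=
  IsClosedForm br F ∧ IsCoclosed br g F ∧ ∀ x y, ricci0 br g x y = - FF0 g F x y

/-- Nijenhuis tensor `N_J(x,y) = [Jx,Jy] − J[Jx,y] − J[x,Jy] − [x,y]`. -/
def nijenhuis (br : V4 → V4 → V4) (J : V4 →ₗ[ℝ] V4) (x y : V4) : V4 :=
  br (J x) (J y) - J (br (J x) y) - J (br x (J y)) - br x y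

/-- The Lie algebra `2𝒜₂`: `[e₁,e₂] = e₂`, `[e₃,e₄] = e₄`. -/
def br2A2 : V4 → V4 → V4 := fun x y =>
  (x 0 * y 1 - x 1 * y 0) • ee 1 + (x 2 * y 3 - x 3 * y 2) • ee 3

theorem IsAltForm.self_eq_zero {α : V4 → V4 → ℝ} (h : IsAltForm α) (x : V4) : α x x = 0 := by
  linarith [h.skew x x]

theorem IsAltForm.add_right {α : V4 → V4 → ℝ} (h : IsAltForm α) (x y z : V4) :
    α x (y + z) = α x y + α x z := by
  rw [h.skew, h.add_left, h.skew y, h.skew z]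
  ring

theorem IsAltForm.smul_right {α : V4 → V4 → ℝ} (h : IsAltForm α) (a : ℝ) (x y : V4) :
    α x (a • y) = a * α x y := by
  rw [h.skew, h.smul_left, h.skew y]
  ring

theorem sum_smul_ee (x : V4) : x = x 0 • ee 0 + x 1 • ee 1 + x 2 • ee 2 + x 3 • ee 3 := by
  ext i
  fin_cases i <;> simp [ee]

/-- The expansion of a 2-form in the basis `eⁱ ∧ eʲ`, `i < j`. -/
theorem IsAltForm.eq_coords {α : V4 → V4 → ℝ} (h : IsAltForm α) (x y : V4) :
    α x y = α (ee 0) (ee 1) * (x 0 * y 1 - x 1 * y 0)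
      + α (ee 0) (ee 2) * (x 0 * y 2 - x 2 * y 0) + α (ee 0) (ee 3) * (x 0 * y 3 - x 3 * y 0)
      + α (ee 1) (ee 2) * (x 1 * y 2 - x 2 * y 1) + α (ee 1) (ee 3) * (x 1 * y 3 - x 3 * y 1)
      + α (ee 2) (ee 3) * (x 2 * y 3 - x 3 * y 2) := by
  conv_lhs => rw [sum_smul_ee x, sum_smul_ee y]
  simp only [h.add_left, h.smul_left, h.add_right, h.smul_right, h.self_eq_zero,
    h.skew (ee 1) (ee 0), h.skew (ee 2) (ee 0), h.skew (ee 3) (ee 0), h.skew (ee 2) (ee 1),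
    h.skew (ee 3) (ee 1), h.skew (ee 3) (ee 2)]
  ring

/-- The metric `e¹⊗e¹ + e²⊗e² + c e³⊗e³ + e⁴⊗e⁴`. -/
def diagMetric (c : ℝ) (x y : V4) : ℝ :=
  x 0 * y 0 + x 1 * y 1 + c * (x 2 * y 2) + x 3 * y 3

/-- The 2-form `p e¹∧e² + q e³∧e⁴`. -/
def blockForm (p q : ℝ) (x y : V4) : ℝ :=
  p * (x 0 * y 1 - x 1 * y 0) + q * (x 2 * y 3 - x 3 * y 2)

theorem isInnerProduct_diagMetric {c : ℝ} (hc : 0 < c) : IsInnerProduct (diagMetric c) where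
  symm x y := by simp only [diagMetric]; ring
  add_left x y z := by simp only [diagMetric, Pi.add_apply]; ring
  smul_left a x y := by simp only [diagMetric, Pi.smul_apply, smul_eq_mul]; ring
  pos x hx := by
    obtain ⟨i, hi⟩ := Function.ne_iff.mp hx
    have hi' : 0 < x i * x i := mul_self_pos.mpr hi
    have h2 := mul_nonneg hc.le (mul_self_nonneg (x 2))
    unfold diagMetric
    fin_cases i
    · replace hi' : 0 < x 0 * x 0 := hi'
      linarith [mul_self_nonneg (x 1), mul_self_nonneg (x 3)]
    · replace hi' : 0 < x 1 * x 1 := hi'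
      linarith [mul_self_nonneg (x 0), mul_self_nonneg (x 3)]
    · replace hi' : 0 < x 2 * x 2 := hi'
      linarith [mul_self_nonneg (x 0), mul_self_nonneg (x 1), mul_self_nonneg (x 3),
        mul_pos hc hi']
    · replace hi' : 0 < x 3 * x 3 := hi'
      linarith [mul_self_nonneg (x 0), mul_self_nonneg (x 1)]

theorem isAltForm_blockForm (p q : ℝ) : IsAltForm (blockForm p q) where
  skew x y := by simp only [blockForm]; ring
  add_left x y z := by simp only [blockForm, Pi.add_apply]; ring
  smul_left a x y := by simp only [blockForm, Pi.smul_apply, smul_eq_mul]; ring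

theorem br2A2_eq (x y : V4) :
    br2A2 x y = ![0, x 0 * y 1 - x 1 * y 0, 0, x 2 * y 3 - x 3 * y 2] := by
  ext i
  fin_cases i <;> simp [br2A2, ee]

theorem isClosedForm_blockForm (p q : ℝ) : IsClosedForm br2A2 (blockForm p q) := by
  intro x y z
  simp [cdiff, br2A2_eq, blockForm]
  ring

theorem gram_diagMetric (c : ℝ) : gram (diagMetric c) = Matrix.diagonal ![1, 1, c, 1] := by
  ext i j
  fin_cases i <;> fin_cases j <;> simp [gram, diagMetric, ee]

theorem ginv_diagMetric {c : ℝ} (hc : c ≠ 0) :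
    ginv (diagMetric c) = Matrix.diagonal ![1, 1, c⁻¹, 1] := by
  rw [ginv, gram_diagMetric]
  apply Matrix.inv_eq_right_inv
  rw [Matrix.diagonal_mul_diagonal, ← Matrix.diagonal_one]
  congr 1
  ext i
  fin_cases i <;> simp [hc]

theorem det_gram_diagMetric (c : ℝ) : (gram (diagMetric c)).det = c := by
  simp [gram_diagMetric, Fin.prod_univ_four]

theorem formInner_diagMetric_blockForm {c : ℝ} (hc : c ≠ 0) (p q : ℝ) {α : V4 → V4 → ℝ}
    (h : IsAltForm α) :
    formInner (diagMetric c) α (blockForm p q)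
      = p * α (ee 0) (ee 1) + q / c * α (ee 2) (ee 3) := by
  have h1 := h.skew (ee 1) (ee 0)
  have h2 := h.skew (ee 3) (ee 2)
  simp [formInner, ginv_diagMetric hc, Fin.sum_univ_four, Matrix.diagonal_apply, blockForm, ee]
    at h1 h2 ⊢
  rw [h1, h2]
  ring

theorem vol_diagMetric (c : ℝ) (x y z w : V4) :
    vol (diagMetric c) x y z w
      = √c * wedge22 (blockForm 1 0) (blockForm 0 1) x y z w := by
  rw [vol, det_gram_diagMetric]
  simp [Matrix.det_succ_row_zero, Fin.sum_univ_succ, Fin.succAbove, wedge22, blockForm]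
  left
  ring

theorem isHodgeStar_blockForm {c : ℝ} (hc : 0 < c) (p q : ℝ) :
    IsHodgeStar (diagMetric c) (blockForm p q) (blockForm (q / √c) (p * √c)) := by
  refine ⟨isAltForm_blockForm _ _, fun α h x y z w => ?_⟩
  have hs : q / c * √c = q / √c := by
    rw [div_mul_eq_mul_div, div_eq_div_iff hc.ne' (Real.sqrt_pos.mpr hc).ne', mul_assoc,
      Real.mul_self_sqrt hc.le]
  rw [formInner_diagMetric_blockForm hc.ne' p q h, vol_diagMetric]
  rw [← mul_assoc, add_mul, mul_right_comm (q / c), hs]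
  simp only [wedge22, blockForm, h.eq_coords x, h.eq_coords y, h.eq_coords z]
  ring

theorem LC_diagMetric {c : ℝ} (hc : c ≠ 0) (x y : V4) :
    LC br2A2 (diagMetric c) x y = ![x 1 * y 1, -(x 1 * y 0), x 3 * y 3 / c, -(x 3 * y 2)] := by
  ext i
  fin_cases i <;>
  · simp [LC, koszul, ginv_diagMetric hc, Matrix.diagonal_apply, br2A2_eq,
      diagMetric, ee]
    ring

theorem ricci_diagMetric {c : ℝ} (hc : c ≠ 0) (x y : V4) :
    ricci br2A2 (diagMetric c) x y
      = -(x 0 * y 0) - x 1 * y 1 - x 2 * y 2 - x 3 * y 3 / c := by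
  simp [ricci, curv, LC_diagMetric hc, br2A2_eq, Fin.sum_univ_four, ee]
  ring

theorem scal_diagMetric {c : ℝ} (hc : c ≠ 0) :
    scal br2A2 (diagMetric c) = -2 - 2 / c := by
  simp [scal, ricci_diagMetric hc, ginv_diagMetric hc, Fin.sum_univ_four, Matrix.diagonal_apply, ee]
  ring

theorem ricci0_diagMetric {c : ℝ} (hc : c ≠ 0) (x y : V4) :
    ricci0 br2A2 (diagMetric c) x y
      = (1 / c - 1) / 2 * (x 0 * y 0 + x 1 * y 1 - c * (x 2 * y 2) - x 3 * y 3) := by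
  rw [ricci0, ricci_diagMetric hc, scal_diagMetric hc, diagMetric]
  field_simp
  ring

theorem fhat_blockForm {c : ℝ} (hc : c ≠ 0) (p q : ℝ) (x : V4) :
    fhat (diagMetric c) (blockForm p q) x
      = ![-(p * x 1), p * x 0, -(q * x 3 / c), q * x 2] := by
  ext i
  fin_cases i <;>
  simp [fhat, ginv_diagMetric hc, Matrix.diagonal_apply, blockForm, ee,
    div_eq_mul_inv]

theorem FF0_blockForm {c : ℝ} (hc : c ≠ 0) (p q : ℝ) (x y : V4) :
    FF0 (diagMetric c) (blockForm p q) x y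
      = (q ^ 2 / c - p ^ 2) / 2 * (x 0 * y 0 + x 1 * y 1 - c * (x 2 * y 2) - x 3 * y 3) := by
  simp [FF0, fhat_blockForm hc, diagMetric, Fin.sum_univ_four, ee]
  field_simp
  ring

/-- on `2𝒜₂`, for `a₅ = (1+a₃₄²)/(1+a₁₂²) ≠ 1`, the metric
`g = e¹⊗e¹ + e²⊗e² + a₅ e³⊗e³ + e⁴⊗e⁴` with `F = a₁₂ e¹∧e² + a₃₄ e³∧e⁴` is a
non-Einstein solution of the Einstein--Maxwell equations. -/
theorem stmt0 (a12 a34 a5 : ℝ)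
    (ha5 : a5 = (1 + a34 ^ 2) / (1 + a12 ^ 2)) (hne : a5 ≠ 1)
    (g F : V4 → V4 → ℝ)
    (hg : g = fun x y => x 0 * y 0 + x 1 * y 1 + a5 * (x 2 * y 2) + x 3 * y 3)
    (hF : F = fun x y => a12 * (x 0 * y 1 - x 1 * y 0) + a34 * (x 2 * y 3 - x 3 * y 2)) :
    IsInnerProduct g ∧ IsAltForm F ∧ IsEMSolution br2A2 g F ∧ ¬ IsEinstein br2A2 g := by
  obtain rfl : g = diagMetric a5 := hg
  obtain rfl : F = blockForm a12 a34 := hF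
  have hc : 0 < a5 := ha5 ▸ by positivity
  refine ⟨isInnerProduct_diagMetric hc, isAltForm_blockForm _ _,
    ⟨isClosedForm_blockForm _ _, ⟨_, isHodgeStar_blockForm hc _ _, isClosedForm_blockForm _ _⟩,
      fun x y => ?_⟩, fun h => hne ?_⟩
  · have key : 1 / a5 - 1 = -(a34 ^ 2 / a5 - a12 ^ 2) := by
      rw [eq_div_iff (by positivity)] at ha5
      field_simp
      linarith
    rw [ricci0_diagMetric hc.ne', FF0_blockForm hc.ne', key]
    ring
  · have h0 := h (ee 0) (ee 0)
    simp [ricci0_diagMetric hc.ne', ee] at h0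
    exact inv_eq_one.mp (sub_eq_zero.mp h0)
end
end

section
/- Let 𝔤 = 𝒜₂ ⊕ 2𝒜₁ be the 4-dimensional real Lie algebra with the single bracket [e₁,e₂] = e₂. Let a₁₂, a₃₄ ∈ ℝ satisfy a₃₄² − a₁₂² = 1. Then the Euclidean inner product g = e¹⊗e¹ + e²⊗e² + e³⊗e³ + e⁴⊗e⁴ together with the 2-form F = a₁₂ e¹∧e² + a₃₄ e³∧e⁴ is a solution of the Einstein–Maxwell equations, and g is not Einstein. -/
open scoped BigOperators

noncomputable section

/-- The Lie algebra `𝒜₂ ⊕ 2𝒜₁`: `[e₁,e₂] = e₂`. -/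
def brA2A1A1 : V4 → V4 → V4 := fun x y =>
  (x 0 * y 1 - x 1 * y 0) • ee 1

/-- The standard Euclidean inner product on `ℝ⁴`. -/
def euclid : V4 → V4 → ℝ := fun x y => x 0 * y 0 + x 1 * y 1 + x 2 * y 2 + x 3 * y 3

/-- The 2-form `a e¹∧e² + b e³∧e⁴`. -/
def diagForm (a b : ℝ) : V4 → V4 → ℝ := fun x y =>
  a * (x 0 * y 1 - x 1 * y 0) + b * (x 2 * y 3 - x 3 * y 2)

theorem isInnerProduct_euclid : IsInnerProduct euclid where
  symm x y := by simp only [euclid]; ring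
  add_left x y z := by simp only [euclid, Pi.add_apply]; ring
  smul_left a x y := by simp only [euclid, Pi.smul_apply, smul_eq_mul]; ring
  pos x hx := by
    obtain ⟨i, hi⟩ := Function.ne_iff.mp hx
    have hi' : 0 < x i * x i := mul_self_pos.mpr hi
    have h := fun j => mul_self_nonneg (x j)
    simp only [euclid]
    fin_cases i <;> simp only [Fin.zero_eta, Fin.mk_one, Fin.reduceFinMk] at hi' <;>
      linarith [h 0, h 1, h 2, h 3]

theorem isAltForm_diagForm (a b : ℝ) : IsAltForm (diagForm a b) where
  skew x y := by simp only [diagForm]; ring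
  add_left x y z := by simp only [diagForm, Pi.add_apply]; ring
  smul_left c x y := by simp only [diagForm, Pi.smul_apply, smul_eq_mul]; ring

theorem IsAltForm.apply_eq_sum {α : V4 → V4 → ℝ} (hα : IsAltForm α) (x y : V4) :
    α x y = ∑ i, ∑ j, x i * y j * α (ee i) (ee j) := by
  have expand (u v : V4) : α u v = ∑ i, u i * α (ee i) v := by
    have hu : u = u 0 • ee 0 + u 1 • ee 1 + u 2 • ee 2 + u 3 • ee 3 := by
      ext i
      fin_cases i <;> simp [ee]
    conv_lhs => rw [hu]
    simp only [hα.add_left, hα.smul_left, Fin.sum_univ_four]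
  rw [expand x y]
  refine Finset.sum_congr rfl fun i _ => ?_
  rw [hα.skew, expand y (ee i), ← Finset.sum_neg_distrib, Finset.mul_sum]
  refine Finset.sum_congr rfl fun j _ => ?_
  rw [hα.skew (ee j) (ee i)]
  ring

theorem gram_euclid : gram euclid = 1 := by
  ext i j
  fin_cases i <;> fin_cases j <;> simp [gram, euclid, ee]

theorem ginv_euclid : ginv euclid = 1 := by
  rw [ginv, gram_euclid, inv_one]

theorem formInner_euclid_diagForm (a b : ℝ) {α : V4 → V4 → ℝ} (hα : IsAltForm α) :
    formInner euclid α (diagForm a b) = a * α (ee 0) (ee 1) + b * α (ee 2) (ee 3) := by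
  simp [formInner, ginv_euclid, Matrix.one_apply, Fin.sum_univ_four, diagForm, ee]
  have h₁ := hα.skew (ee 0) (ee 1)
  have h₂ := hα.skew (ee 2) (ee 3)
  simp only [ee] at h₁ h₂
  rw [h₁, h₂]
  ring

theorem vol_euclid (x y z w : V4) :
    vol euclid x y z w = Matrix.det (Matrix.of ![x, y, z, w]) := by
  rw [vol, gram_euclid, Matrix.det_one, Real.sqrt_one, one_mul]

theorem isHodgeStar_diagForm (a b : ℝ) :
    IsHodgeStar euclid (diagForm a b) (diagForm b a) := by
  refine ⟨isAltForm_diagForm b a, fun α hα x y z w => ?_⟩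
  have hdiag (i : Fin 4) : α (ee i) (ee i) = 0 := by linarith [hα.skew (ee i) (ee i)]
  rw [formInner_euclid_diagForm a b hα, vol_euclid]
  simp only [wedge22, hα.apply_eq_sum x, hα.apply_eq_sum y, hα.apply_eq_sum z,
    Fin.sum_univ_four, hdiag, hα.skew (ee 1) (ee 0), hα.skew (ee 2) (ee 0),
    hα.skew (ee 3) (ee 0), hα.skew (ee 2) (ee 1), hα.skew (ee 3) (ee 1),
    hα.skew (ee 3) (ee 2), diagForm]
  simp [Matrix.det_succ_row_zero, Fin.sum_univ_succ, Fin.succAbove]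
  ring

theorem isClosedForm_diagForm (a b : ℝ) : IsClosedForm brA2A1A1 (diagForm a b) := by
  intro x y z
  simp [cdiff, diagForm, brA2A1A1, ee]
  ring

theorem LC_euclid (x y : V4) : LC brA2A1A1 euclid x y = ![x 1 * y 1, -(x 1 * y 0), 0, 0] := by
  ext m
  simp only [LC, ginv_euclid, Matrix.one_apply, mul_ite, mul_one, mul_zero, Finset.sum_ite_eq',
    Finset.mem_univ, if_true]
  fin_cases m <;> simp [koszul, euclid, brA2A1A1, ee] <;> ring

theorem ricci_euclid (x y : V4) : ricci brA2A1A1 euclid x y = -(x 0 * y 0 + x 1 * y 1) := by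
  simp [ricci, curv, LC_euclid, Fin.sum_univ_four, brA2A1A1, ee]
  ring

theorem scal_euclid : scal brA2A1A1 euclid = -2 := by
  simp [scal, ginv_euclid, ricci_euclid, Fin.sum_univ_four, Matrix.one_apply, ee]
  norm_num

theorem ricci0_euclid (x y : V4) :
    ricci0 brA2A1A1 euclid x y =
      (-(x 0 * y 0) - x 1 * y 1 + x 2 * y 2 + x 3 * y 3) / 2 := by
  rw [ricci0, ricci_euclid, scal_euclid, euclid]
  ring

theorem fhat_euclid (a b : ℝ) (x : V4) :
    fhat euclid (diagForm a b) x = ![-(a * x 1), a * x 0, -(b * x 3), b * x 2] := by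
  ext m
  simp only [fhat, ginv_euclid, Matrix.one_apply, mul_ite, mul_one, mul_zero, Finset.sum_ite_eq',
    Finset.mem_univ, if_true]
  fin_cases m <;> simp [diagForm, ee]

theorem FF0_euclid (a b : ℝ) (x y : V4) :
    FF0 euclid (diagForm a b) x y =
      (b ^ 2 - a ^ 2) / 2 * (x 0 * y 0 + x 1 * y 1 - x 2 * y 2 - x 3 * y 3) := by
  simp [FF0, fhat_euclid, Fin.sum_univ_four, euclid, ee]
  ring

/-- on `𝒜₂ ⊕ 2𝒜₁`, if `a₃₄² − a₁₂² = 1` then the Euclidean metric with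
`F = a₁₂ e¹∧e² + a₃₄ e³∧e⁴` is a non-Einstein solution of the Einstein--Maxwell equations. -/
theorem stmt2 (a12 a34 : ℝ) (h : a34 ^ 2 - a12 ^ 2 = 1)
    (g F : V4 → V4 → ℝ)
    (hg : g = fun x y => x 0 * y 0 + x 1 * y 1 + x 2 * y 2 + x 3 * y 3)
    (hF : F = fun x y => a12 * (x 0 * y 1 - x 1 * y 0) + a34 * (x 2 * y 3 - x 3 * y 2)) :
    IsInnerProduct g ∧ IsAltForm F ∧ IsEMSolution brA2A1A1 g F ∧ ¬ IsEinstein brA2A1A1 g := by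
  obtain rfl : g = euclid := hg
  obtain rfl : F = diagForm a12 a34 := hF
  refine ⟨isInnerProduct_euclid, isAltForm_diagForm _ _,
    ⟨isClosedForm_diagForm _ _, ⟨_, isHodgeStar_diagForm _ _, isClosedForm_diagForm _ _⟩,
      fun x y => ?_⟩, fun hE => ?_⟩
  · rw [ricci0_euclid, FF0_euclid, h]
    ring
  · have h₀ := hE (ee 0) (ee 0)
    rw [ricci0_euclid] at h₀
    simp [ee] at h₀
end
end

section
/- Let 𝔤 = 2𝒜₂ be the 4-dimensional real Lie algebra with brackets [e₁,e₂] = e₂ and [e₃,e₄] = e₄, let a₅ > 0, and let g = e¹⊗e¹ + e²⊗e² + a₅ e³⊗e³ + e⁴⊗e⁴. Then the 2-form ω = e¹∧e² + √a₅ e³∧e⁴ satisfies dω = 0, the endomorphism J of 𝔤 determined by g(Jx,y) = ω(x,y) satisfies J∘J = −id and g(Jx,Jy) = g(x,y) for all x,y, and the Nijenhuis tensor N_J(x,y) = [Jx,Jy] − J[Jx,y] − J[x,Jy] − [x,y] vanishes identically. In other words, g is a Kähler metric with Kähler form ω. -/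
open scoped BigOperators

noncomputable section

/-- on `2𝒜₂` with `a₅ > 0`, the metric
`g = e¹⊗e¹ + e²⊗e² + a₅ e³⊗e³ + e⁴⊗e⁴` is Kähler with Kähler form
`ω = e¹∧e² + √a₅ e³∧e⁴`: `dω = 0`, and the endomorphism `J` determined by `g(Jx,y) = ω(x,y)`
satisfies `J∘J = −id`, is `g`-orthogonal, and has vanishing Nijenhuis tensor. -/
theorem stmt5 (a5 : ℝ) (ha5 : 0 < a5)
    (g ω : V4 → V4 → ℝ)
    (hg : g = fun x y => x 0 * y 0 + x 1 * y 1 + a5 * (x 2 * y 2) + x 3 * y 3)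
    (hω : ω = fun x y => (x 0 * y 1 - x 1 * y 0) + Real.sqrt a5 * (x 2 * y 3 - x 3 * y 2)) :
    IsClosedForm br2A2 ω ∧
    (∃ J : V4 →ₗ[ℝ] V4, ∀ x y, g (J x) y = ω x y) ∧
    (∀ J : V4 →ₗ[ℝ] V4, (∀ x y, g (J x) y = ω x y) →
      (∀ x, J (J x) = - x) ∧
      (∀ x y, g (J x) (J y) = g x y) ∧
      (∀ x y, nijenhuis br2A2 J x y = 0)) := by
  obtain ⟨s, hs, rfl⟩ : ∃ s : ℝ, 0 < s ∧ a5 = s ^ 2 :=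
    ⟨Real.sqrt a5, Real.sqrt_pos.2 ha5, (Real.sq_sqrt ha5.le).symm⟩
  have hs0 : s ≠ 0 := hs.ne'
  rw [Real.sqrt_sq hs.le] at hω
  subst hg hω
  refine ⟨fun x y z => ?_, ⟨Matrix.mulVecLin
    !![0, -1, 0, 0; 1, 0, 0, 0; 0, 0, 0, -s⁻¹; 0, 0, s, 0], fun x y => ?_⟩, fun J hJ => ?_⟩
  · simp [cdiff, br2A2, ee]
    ring
  · simp [Matrix.mulVec, dotProduct, Fin.sum_univ_four]
    field_simp
    ring
  have h0 (x : V4) : J x 0 = -x 1 := by simpa [ee] using hJ x (ee 0)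
  have h1 (x : V4) : J x 1 = x 0 := by simpa [ee] using hJ x (ee 1)
  have h2 (x : V4) : J x 2 = -(x 3 / s) := by
    have h : s ^ 2 * J x 2 = -(s * x 3) := by simpa [ee] using hJ x (ee 2)
    field_simp
    apply mul_left_cancel₀ hs0
    linear_combination h
  have h3 (x : V4) : J x 3 = s * x 2 := by simpa [ee] using hJ x (ee 3)
  refine ⟨fun x => ?_, fun x y => ?_, fun x y => ?_⟩
  · ext i
    fin_cases i <;> simp [h0, h1, h2, h3, hs0]
    field_simp
  · simp only [h0, h1, h2, h3]
    field_simp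
    ring
  · ext i
    fin_cases i <;> simp [nijenhuis, h0, h1, h2, h3, br2A2, ee] <;> field_simp <;> ring
end
end

section
/- Let 𝔤 = 𝒜₄,₉^{−1/2} be the 4-dimensional real Lie algebra with brackets [e₂,e₃] = e₁, [e₁,e₄] = (1/2)e₁, [e₂,e₄] = e₂, [e₃,e₄] = −(1/2)e₃, and let g = e¹⊗e¹ + e²⊗e² + e³⊗e³ + e⁴⊗e⁴ be the Euclidean inner product. Let J be the endomorphism of 𝔤 with Je₁ = e₃, Je₃ = −e₁, Je₂ = −e₄, Je₄ = e₂, and let ω = e¹∧e³ − e²∧e⁴. Then: (i) dω = 0; (ii) J∘J = −id, g(Jx,Jy) = g(x,y), and ω(x,y) = g(Jx,y) for all x,y; (iii) the Nijenhuis tensor N_J(x,y) = [Jx,Jy] − J[Jx,y] − J[x,Jy] − [x,y] does not vanish identically; (iv) the Ricci tensor of g is J-invariant, i.e., Ric(Jx,Jy) = Ric(x,y) for all x,y. In other words, g is a strictly (non-Kähler) almost-Kähler metric with J-invariant Ricci tensor. -/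
open scoped BigOperators

noncomputable section

/-- The Lie algebra `𝒜₄,₉^{-1/2}`:
`[e₂,e₃] = e₁`, `[e₁,e₄] = (1/2)e₁`, `[e₂,e₄] = e₂`, `[e₃,e₄] = −(1/2)e₃`. -/
def brA49h : V4 → V4 → V4 := fun x y =>
  ((x 1 * y 2 - x 2 * y 1) + (1 / 2) * (x 0 * y 3 - x 3 * y 0)) • ee 0
    + (x 1 * y 3 - x 3 * y 1) • ee 1
    + (-(1 / 2) * (x 2 * y 3 - x 3 * y 2)) • ee 2

/-- The Euclidean inner product on `V4`. -/
def euclideanForm : V4 → V4 → ℝ := fun x y => x 0 * y 0 + x 1 * y 1 + x 2 * y 2 + x 3 * y 3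

/-- The almost complex structure `J e₁ = e₃`, `J e₂ = −e₄`, `J e₃ = −e₁`, `J e₄ = e₂`. -/
def stdJ : V4 →ₗ[ℝ] V4 where
  toFun x := ![-x 2, x 3, x 0, -x 1]
  map_add' x y := by
    ext i
    fin_cases i <;> simp [add_comm]
  map_smul' a x := by
    ext i
    fin_cases i <;> simp

lemma brA49h_eq (x y : V4) :
    brA49h x y = ![(x 1 * y 2 - x 2 * y 1) + (1 / 2) * (x 0 * y 3 - x 3 * y 0),
      x 1 * y 3 - x 3 * y 1, -(1 / 2) * (x 2 * y 3 - x 3 * y 2), 0] := by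
  ext i
  fin_cases i <;> simp [brA49h, ee]

lemma ginv_euclideanForm : ginv euclideanForm = 1 := by
  have h : gram euclideanForm = 1 := by
    ext i j
    fin_cases i <;> fin_cases j <;> simp [gram, euclideanForm, ee]
  rw [ginv, h, inv_one]

lemma LC_brA49h_euclideanForm (x y : V4) :
    LC brA49h euclideanForm x y =
      ![(1 / 2) * (x 0 * y 3 + x 1 * y 2 - x 2 * y 1),
        (1 / 2) * (x 0 * y 2 + x 2 * y 0) + x 1 * y 3,
        -(1 / 2) * (x 0 * y 1 + x 1 * y 0 + x 2 * y 3),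
        -(1 / 2) * (x 0 * y 0) - x 1 * y 1 + (1 / 2) * (x 2 * y 2)] := by
  ext m
  simp only [LC, ginv_euclideanForm, Matrix.one_apply, mul_ite, mul_one, mul_zero,
    Finset.sum_ite_eq', Finset.mem_univ, if_true, koszul, brA49h_eq]
  fin_cases m <;> simp [euclideanForm, ee] <;> ring

lemma ricci_brA49h_euclideanForm (x y : V4) :
    ricci brA49h euclideanForm x y = -(3 / 2) * (x 1 * y 1 + x 3 * y 3) := by
  simp only [ricci, curv, LC_brA49h_euclideanForm, brA49h_eq, Fin.sum_univ_four]
  simp [ee]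
  ring

lemma eq_stdJ {J : V4 →ₗ[ℝ] V4}
    (h : J (ee 0) = ee 2 ∧ J (ee 1) = - ee 3 ∧ J (ee 2) = - ee 0 ∧ J (ee 3) = ee 1) :
    J = stdJ := by
  obtain ⟨h0, h1, h2, h3⟩ := h
  refine (Pi.basisFun ℝ (Fin 4)).ext fun i => ?_
  rw [Pi.basisFun_apply]
  change J (ee i) = stdJ (ee i)
  fin_cases i <;> simp only [Fin.zero_eta, Fin.mk_one, Fin.reduceFinMk, h0, h1, h2, h3] <;>
    ext j <;> fin_cases j <;> simp [stdJ, ee]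

/-- on `𝒜₄,₉^{-1/2}`, the Euclidean metric with `J e₁ = e₃`, `J e₂ = −e₄`,
`J e₃ = −e₁`, `J e₄ = e₂` and `ω = e¹∧e³ − e²∧e⁴` is a strictly (non-Kähler) almost-Kähler
structure with `J`-invariant Ricci tensor. -/
theorem stmt6 (g ω : V4 → V4 → ℝ)
    (hg : g = fun x y => x 0 * y 0 + x 1 * y 1 + x 2 * y 2 + x 3 * y 3)
    (hω : ω = fun x y => (x 0 * y 2 - x 2 * y 0) - (x 1 * y 3 - x 3 * y 1)) :
    (∃ J : V4 →ₗ[ℝ] V4,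
      J (ee 0) = ee 2 ∧ J (ee 1) = - ee 3 ∧ J (ee 2) = - ee 0 ∧ J (ee 3) = ee 1) ∧
    (∀ J : V4 →ₗ[ℝ] V4,
      (J (ee 0) = ee 2 ∧ J (ee 1) = - ee 3 ∧ J (ee 2) = - ee 0 ∧ J (ee 3) = ee 1) →
      IsClosedForm brA49h ω ∧
      (∀ x, J (J x) = - x) ∧
      (∀ x y, g (J x) (J y) = g x y) ∧
      (∀ x y, ω x y = g (J x) y) ∧
      ¬ (∀ x y, nijenhuis brA49h J x y = 0) ∧
      (∀ x y, ricci brA49h g (J x) (J y) = ricci brA49h g x y)) := by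
  subst hω
  obtain rfl : g = euclideanForm := hg
  refine ⟨⟨stdJ, ?_, ?_, ?_, ?_⟩, fun J hJ => ?_⟩
  iterate 4
    · ext j
      fin_cases j <;> simp [stdJ, ee]
  rw [eq_stdJ hJ]
  refine ⟨fun x y z => ?_, fun x => ?_, fun x y => ?_, fun x y => ?_, fun h => ?_, fun x y => ?_⟩
  · simp [cdiff, brA49h_eq]
    ring
  · ext i
    fin_cases i <;> simp [stdJ]
  · simp [stdJ, euclideanForm]
    ring
  · simp [stdJ, euclideanForm]
    ring
  · have h01 := congrFun (h (ee 0) (ee 1)) 2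
    simp [nijenhuis, brA49h_eq, stdJ, ee] at h01
    norm_num at h01
  · simp [ricci_brA49h_euclideanForm, stdJ]
    ring
end
end
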